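/- Let I be a monomial ideal in k[ℕA] and let p_F be an associated prime of I. Let R = k[ℕA]_{p_F} be the localization at p_F, M = R/I·R, and let N ⊆ M be the submodule of elements annihilated by some power of the maximal ideal of R (equivalently, the largest submodule of M of finite length). Then the length of N as an R-module is finite and equals the number of overlap classes of standard pairs of I that belong to F. -/

import Mathlib

open scoped BigOperators

namespace StdPairsPaper

/-- The coercion of a lattice point to a real vector. -/
def toR {d : ℕ} (v : Fin d → ℤ) : Fin d → ℝ := fun i => (v i : ℝ)

/-- The cone of nonnegative real combinations of (the real images of) elements of `S`. -/
def cone {d : ℕ} (S : Set (Fin d → ℤ)) : Set (Fin d → ℝ) :=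
  {x | ∃ (t : Finset (Fin d → ℤ)) (c : (Fin d → ℤ) → ℝ),
    (t : Set (Fin d → ℤ)) ⊆ S ∧ (∀ v, 0 ≤ c v) ∧ x = ∑ v ∈ t, c v • toR v}

/-- `ℕS`, the submonoid of `ℤ^d` generated by `S`. -/
def NSemi {d : ℕ} (S : Set (Fin d → ℤ)) : AddSubmonoid (Fin d → ℤ) :=
  AddSubmonoid.closure S

/-- `ℤS`, the subgroup of `ℤ^d` generated by `S`. -/
def ZGrp {d : ℕ} (S : Set (Fin d → ℤ)) : AddSubgroup (Fin d → ℤ) :=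
  AddSubgroup.closure S

/-- `ℝS`, the real linear span of `S`. -/
def RSpan {d : ℕ} (S : Set (Fin d → ℤ)) : Submodule ℝ (Fin d → ℝ) :=
  Submodule.span ℝ (toR '' S)

/-- `A` is a configuration: a finite set of nonzero lattice points whose `ℤ`-span is `ℤ^d`
and whose nonnegative real cone is strongly convex (contains no line, i.e. is pointed). -/
structure IsConfig {d : ℕ} (A : Set (Fin d → ℤ)) : Prop where
  (finite : A.Finite)
  (nonzero : (0 : Fin d → ℤ) ∉ A)
  (spans : ZGrp A = ⊤)
  (pointed : ∀ x ∈ cone A, -x ∈ cone A → x = 0)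

/-- `F` is a face of the configuration `A`: `F ⊆ A`, the cone over `F` is an extreme
subset (face) of the cone over `A`, and `ℝ_{≥0}F ∩ A = F`. -/
def IsFace {d : ℕ} (A F : Set (Fin d → ℤ)) : Prop :=
  F ⊆ A ∧ IsExtreme ℝ (cone A) (cone F) ∧ cone F ∩ (toR '' A) = toR '' F

/-- The set `a + ℕF`. -/
def cell {d : ℕ} (a : Fin d → ℤ) (F : Set (Fin d → ℤ)) : Set (Fin d → ℤ) :=
  {x | ∃ f ∈ NSemi F, x = a + f}

/-- Two pairs `(a,F)` and `(b,F)` belonging to the same face `F` overlap: `a - b ∈ ℤF`. -/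
def Overlap {d : ℕ} (F : Set (Fin d → ℤ)) (a b : Fin d → ℤ) : Prop :=
  a - b ∈ ZGrp F

/-- The pair `(a,F)` divides the pair `(b,G)`:
there is `c ∈ ℕA` with `a + c + ℕF ⊆ b + ℕG`. -/
def PairDvd {d : ℕ} (A : Set (Fin d → ℤ)) (a : Fin d → ℤ) (F : Set (Fin d → ℤ))
    (b : Fin d → ℤ) (G : Set (Fin d → ℤ)) : Prop :=
  ∃ c ∈ NSemi A, cell (a + c) F ⊆ cell b G

/-- `E` is the exponent set of a monomial ideal of `ℕA`: `E ⊆ ℕA` and `E + ℕA ⊆ E`. -/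
def IsExpSet {d : ℕ} (A E : Set (Fin d → ℤ)) : Prop :=
  E ⊆ (NSemi A : Set (Fin d → ℤ)) ∧ ∀ e ∈ E, ∀ c ∈ NSemi A, e + c ∈ E

/-- The standard monomials of `E`: `ℕA ∖ E`. -/
def stdSet {d : ℕ} (A E : Set (Fin d → ℤ)) : Set (Fin d → ℤ) :=
  (NSemi A : Set (Fin d → ℤ)) \ E

/-- `(a,F)` is a proper pair of `E`: a pair of `A` with `a + ℕF ⊆ std(E)`. -/
def ProperPair {d : ℕ} (A E : Set (Fin d → ℤ)) (a : Fin d → ℤ)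
    (F : Set (Fin d → ℤ)) : Prop :=
  a ∈ NSemi A ∧ IsFace A F ∧ cell a F ⊆ stdSet A E

/-- `(a,F)` is a standard pair of `E`: a proper pair of `E` maximal with respect to
the partial order `(a,F) ≼ (b,G) ↔ a + ℕF ⊆ b + ℕG`. -/
def StdPair {d : ℕ} (A E : Set (Fin d → ℤ)) (a : Fin d → ℤ)
    (F : Set (Fin d → ℤ)) : Prop :=
  ProperPair A E a F ∧
    ∀ b G, ProperPair A E b G → cell a F ⊆ cell b G → cell b G ⊆ cell a F

/-- The overlap class of the standard pair `(a,F)` of `E` is maximal with respect to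
divisibility among overlap classes of standard pairs of `E`. -/
def MaxClass {d : ℕ} (A E : Set (Fin d → ℤ)) (a : Fin d → ℤ)
    (F : Set (Fin d → ℤ)) : Prop :=
  ∀ b G, StdPair A E b G → PairDvd A a F b G → PairDvd A b G a F

noncomputable section

/-- The affine semigroup ring `k[ℕA]`. -/
abbrev SGRing {d : ℕ} (k : Type*) [Field k] (A : Set (Fin d → ℤ)) :=
  AddMonoidAlgebra k (NSemi A)

/-- The monomial `t^a` of `k[ℕA]`. -/
def mono {d : ℕ} (k : Type*) [Field k] (A : Set (Fin d → ℤ)) (a : (NSemi A)) :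
    SGRing k A :=
  AddMonoidAlgebra.single a 1

/-- `I` is a monomial ideal of `k[ℕA]`: an ideal generated by monomials. -/
def IsMonomialIdeal {d : ℕ} (k : Type*) [Field k] (A : Set (Fin d → ℤ))
    (I : Ideal (SGRing k A)) : Prop :=
  ∃ S : Set (NSemi A), I = Ideal.span ((fun a => mono k A a) '' S)

/-- The exponent set `E(I) = {a ∈ ℕA : t^a ∈ I}` of an ideal of `k[ℕA]`,
as a subset of `ℤ^d`. -/
def expSet {d : ℕ} (k : Type*) [Field k] (A : Set (Fin d → ℤ))
    (I : Ideal (SGRing k A)) : Set (Fin d → ℤ) :=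
  {x | ∃ h : x ∈ NSemi A, mono k A ⟨x, h⟩ ∈ I}

/-- The monomial prime ideal `p_F = ⟨t^a : a ∈ ℕA ∖ ℕF⟩` of `k[ℕA]`. -/
def primeF {d : ℕ} (k : Type*) [Field k] (A F : Set (Fin d → ℤ)) :
    Ideal (SGRing k A) :=
  Ideal.span {x | ∃ a : (NSemi A), (a : Fin d → ℤ) ∉ NSemi F ∧ x = mono k A a}

end

section RealCones

/-- Nonnegative real coefficients can be replaced by nonnegative integer coefficients with the same
support which satisfy the same integer linear relations. -/
theorem exists_int_of_nonneg {ι : Type*} [Fintype ι] (c : ι → ℝ) (hc : ∀ i, 0 ≤ c i) :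
    ∃ m : ι → ℕ, (∀ i, 0 < c i → 0 < m i) ∧
      ∀ z : ι → ℤ, ∑ i, (z i : ℝ) * c i = 0 → ∑ i, z i * (m i : ℤ) = 0 := by
  classical
  let S : Submodule ℤ ℝ := Submodule.span ℤ (Set.range c)
  have : Module.Finite ℤ S := Module.Finite.span_of_finite ℤ (Set.finite_range c)
  have : Module.Free ℤ S := inferInstance
  let b := Module.Free.chooseBasis ℤ S
  let x : ι → S := fun i => ⟨c i, Submodule.subset_span ⟨i, rfl⟩⟩
  let r : ι → ℝ := fun i => ∑ j, |(b.repr (x i) j : ℝ)|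
  obtain ⟨N, hN⟩ : ∃ N : ℕ, ∀ i, 0 < c i → r i < N * c i := by
    have h : ∀ i, ∃ N : ℕ, 0 < c i → r i < N * c i := fun i => by
      by_cases hi : 0 < c i
      · obtain ⟨N, hN⟩ := exists_nat_gt (r i / c i)
        exact ⟨N, fun _ => (div_lt_iff₀ hi).1 hN⟩
      · exact ⟨0, fun h => absurd h hi⟩
    choose N hN using h
    refine ⟨∑ i, N i, fun i hi => (hN i hi).trans_le ?_⟩
    gcongr
    exact Finset.single_le_sum (f := N) (fun _ _ => Nat.zero_le _) (Finset.mem_univ i)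
  let ψ : S →ₗ[ℤ] ℤ := b.constr ℤ (fun j => round ((N : ℝ) * (b j : ℝ)))
  have hψ : ∀ i, ψ (x i) = ∑ j, b.repr (x i) j * round ((N : ℝ) * (b j : ℝ)) := fun i => by
    simp [ψ, Module.Basis.constr_apply_fintype]
  have hx : ∀ i, c i = ∑ j, (b.repr (x i) j : ℝ) * (b j : ℝ) := fun i => by
    calc c i = ((∑ j, b.repr (x i) j • b j : S) : ℝ) := by rw [b.sum_repr]
      _ = _ := by rw [Submodule.coe_sum]; simp only [Submodule.coe_smul, zsmul_eq_mul]
  have hpos : ∀ i, 0 < c i → 0 < ψ (x i) := fun i hi => by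
    have h1 : |(N : ℝ) * c i - (ψ (x i) : ℝ)| ≤ r i := by
      rw [hψ, hx i, Finset.mul_sum]
      push_cast
      rw [← Finset.sum_sub_distrib]
      refine (Finset.abs_sum_le_sum_abs _ _).trans (Finset.sum_le_sum fun j _ => ?_)
      rw [show (N : ℝ) * ((b.repr (x i) j : ℝ) * (b j : ℝ)) -
        (b.repr (x i) j : ℝ) * (round ((N : ℝ) * (b j : ℝ)) : ℝ) =
        (b.repr (x i) j : ℝ) * ((N : ℝ) * (b j : ℝ) - (round ((N : ℝ) * (b j : ℝ)) : ℝ)) by ring,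
        abs_mul]
      refine mul_le_of_le_one_right (abs_nonneg _) ((abs_sub_round _).trans (by norm_num))
    have h2 := (abs_le.1 h1).2
    have h3 := hN i hi
    have : (0 : ℝ) < ψ (x i) := by linarith
    exact_mod_cast this
  have hnonneg : ∀ i, 0 ≤ ψ (x i) := fun i => by
    rcases (hc i).lt_or_eq with h | h
    · exact (hpos i h).le
    · have : x i = 0 := Subtype.ext h.symm
      simp [this]
  refine ⟨fun i => (ψ (x i)).toNat, fun i hi => by simpa using hpos i hi, fun z hz => ?_⟩
  have h0 : ∑ i, z i • x i = 0 := by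
    apply Subtype.ext
    simpa [x] using hz
  have := congrArg ψ h0
  simpa [hnonneg] using this

variable {d : ℕ}

theorem subset_cone {S : Set (Fin d → ℤ)} {v : Fin d → ℤ} (hv : v ∈ S) : toR v ∈ cone S :=
  ⟨{v}, fun _ => 1, by simpa using hv, fun _ => zero_le_one, by simp⟩

theorem cone_mono {S T : Set (Fin d → ℤ)} (h : S ⊆ T) : cone S ⊆ cone T := by
  rintro x ⟨t, c, ht, hc, rfl⟩
  exact ⟨t, c, ht.trans h, hc, rfl⟩

theorem exists_coeff_of_mem_cone {S : Set (Fin d → ℤ)} (u : Finset (Fin d → ℤ))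
    (hu : S ⊆ u) {x : Fin d → ℝ} (hx : x ∈ cone S) :
    ∃ c : (Fin d → ℤ) → ℝ, (∀ v, 0 ≤ c v) ∧ (∀ v, c v ≠ 0 → v ∈ S) ∧
      x = ∑ v ∈ u, c v • toR v := by
  classical
  obtain ⟨t, c, ht, hc, rfl⟩ := hx
  refine ⟨fun v => if v ∈ t then c v else 0, fun v => ?_, fun v hv => ?_, ?_⟩
  · dsimp only
    split_ifs
    exacts [hc v, le_rfl]
  · by_contra h
    exact hv (if_neg fun h' => h (ht h'))
  · have htu : t ⊆ u := fun v hv => hu (ht hv)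
    rw [← Finset.sum_subset htu]
    · exact Finset.sum_congr rfl fun v hv => by simp [hv]
    · intro v _ hv
      simp [hv]

theorem add_mem_cone {S : Set (Fin d → ℤ)} {x y : Fin d → ℝ} (hx : x ∈ cone S)
    (hy : y ∈ cone S) : x + y ∈ cone S := by
  classical
  obtain ⟨t, c, ht, hc, rfl⟩ := hx
  obtain ⟨s, e, hs, he, rfl⟩ := hy
  have hts : (↑(t ∪ s) : Set (Fin d → ℤ)) ⊆ S := by simp [ht, hs]
  refine ⟨t ∪ s, fun v => (if v ∈ t then c v else 0) + (if v ∈ s then e v else 0), hts,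
    fun v => ?_, ?_⟩
  · dsimp only
    have := hc v
    have := he v
    split_ifs <;> linarith
  · simp only [add_smul, ite_smul, zero_smul, Finset.sum_add_distrib]
    rw [← Finset.sum_filter, ← Finset.sum_filter]
    congr 2 <;> ext v <;> simp +contextual

theorem toR_add (v w : Fin d → ℤ) : toR (v + w) = toR v + toR w := by
  ext i
  simp [toR]

theorem toR_injective : Function.Injective (toR (d := d)) := fun v w h => by
  ext i
  simpa [toR] using congrFun h i

theorem zero_mem_cone (S : Set (Fin d → ℤ)) : (0 : Fin d → ℝ) ∈ cone S :=
  ⟨∅, 0, by simp, fun _ => le_rfl, by simp⟩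

theorem toR_mem_cone_of_mem_NSemi {S : Set (Fin d → ℤ)} {x : Fin d → ℤ} (hx : x ∈ NSemi S) :
    toR x ∈ cone S := by
  induction hx using AddSubmonoid.closure_induction with
  | mem x hx => exact subset_cone hx
  | zero =>
    have : toR (0 : Fin d → ℤ) = 0 := by ext i; simp [toR]
    rw [this]
    exact zero_mem_cone S
  | add x y _ _ hx hy =>
    rw [toR_add]
    exact add_mem_cone hx hy

theorem smul_mem_cone {S : Set (Fin d → ℤ)} {r : ℝ} (hr : 0 ≤ r) {x : Fin d → ℝ}
    (hx : x ∈ cone S) : r • x ∈ cone S := by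
  obtain ⟨t, c, ht, hc, rfl⟩ := hx
  exact ⟨t, fun v => r * c v, ht, fun v => mul_nonneg hr (hc v), by
    simp [Finset.smul_sum, mul_smul]⟩

/-- A subset `G` of a finite set `A` is a face as soon as it contains every `x ∈ A` that divides
an element of `ℕG` in `ℕA`. -/
theorem isFace_of_forall_add_mem {A G : Set (Fin d → ℤ)} (hA : A.Finite) (hGA : G ⊆ A)
    (h : ∀ x ∈ A, ∀ y ∈ NSemi A, x + y ∈ NSemi G → x ∈ G) : IsFace A G := by
  classical
  have key : ∀ c : (Fin d → ℤ) → ℝ, (∀ v, 0 ≤ c v) →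
      ∑ v ∈ hA.toFinset, c v • toR v ∈ cone G → ∀ x ∈ A, 0 < c x → x ∈ G := by
    intro c hc hmem x hx hcx
    obtain ⟨e, he, heG, hsum⟩ := exists_coeff_of_mem_cone hA.toFinset (by simpa using hGA) hmem
    obtain ⟨m, hm, hrel⟩ := exists_int_of_nonneg
      (ι := {v // v ∈ hA.toFinset} ⊕ {v // v ∈ hA.toFinset.filter (· ∈ G)})
      (Sum.elim (fun v => c v) (fun v => e v)) (by rintro (v | v) <;> simp [hc, he])
    have hxA : x ∈ hA.toFinset := by simpa using hx
    have heq : ∑ v : {v // v ∈ hA.toFinset}, m (.inl v) • (v : Fin d → ℤ) =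
        ∑ v : {v // v ∈ hA.toFinset.filter (· ∈ G)}, m (.inr v) • (v : Fin d → ℤ) := by
      ext i
      have := hrel (Sum.elim (fun v => v.1 i) (fun v => - v.1 i)) ?_
      · rw [Fintype.sum_sum_type] at this
        simp only [Sum.elim_inl, Sum.elim_inr, neg_mul, Finset.sum_neg_distrib] at this
        simp only [Finset.sum_apply, Pi.smul_apply]
        simp only [nsmul_eq_mul]
        simp only [mul_comm] at this ⊢
        linarith
      · rw [Fintype.sum_sum_type]
        have h1 := congrFun hsum i
        simp only [Finset.sum_apply, Pi.smul_apply, toR, smul_eq_mul] at h1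
        have h2 : ∑ v : {v // v ∈ hA.toFinset.filter (· ∈ G)}, e v * ((v : Fin d → ℤ) i : ℝ) =
            ∑ v ∈ hA.toFinset, e v * (v i : ℝ) := by
          rw [← Finset.sum_subset (Finset.filter_subset (· ∈ G) hA.toFinset)]
          · exact (Finset.sum_subtype _ (fun _ => Iff.rfl) (fun v => e v * (v i : ℝ))).symm
          · intro v hv hv'
            have : e v = 0 := by
              by_contra h0
              exact hv' (by simp [heG v h0, hGA (heG v h0)])
            simp [this]
        have h3 : ∑ v : {v // v ∈ hA.toFinset}, c v * ((v : Fin d → ℤ) i : ℝ) =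
            ∑ v ∈ hA.toFinset, c v * (v i : ℝ) :=
          (Finset.sum_subtype _ (fun _ => Iff.rfl) (fun v => c v * (v i : ℝ))).symm
        simp only [Sum.elim_inl, Sum.elim_inr]
        push_cast
        simp only [neg_mul, Finset.sum_neg_distrib, mul_comm ((_ : ℤ) : ℝ)]
        rw [h2, h3, h1]
        ring
    have hmx : 0 < m (.inl ⟨x, hxA⟩) := hm _ (by simpa using hcx)
    obtain ⟨n, hn⟩ := Nat.exists_eq_succ_of_ne_zero hmx.ne'
    refine h x hx (n • x + ∑ v ∈ Finset.univ.erase ⟨x, hxA⟩, m (.inl v) • (v : Fin d → ℤ)) ?_ ?_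
    · refine add_mem (AddSubmonoid.nsmul_mem _ (AddSubmonoid.subset_closure hx) _)
        (sum_mem fun v _ => AddSubmonoid.nsmul_mem _ (AddSubmonoid.subset_closure ?_) _)
      exact hA.mem_toFinset.1 v.2
    · have : x + (n • x + ∑ v ∈ Finset.univ.erase ⟨x, hxA⟩, m (.inl v) • (v : Fin d → ℤ)) =
          ∑ v : {v // v ∈ hA.toFinset}, m (.inl v) • (v : Fin d → ℤ) := by
        rw [← Finset.add_sum_erase _ _ (Finset.mem_univ (⟨x, hxA⟩ : {v // v ∈ hA.toFinset})), hn,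
          succ_nsmul']
        abel
      rw [this, heq]
      exact sum_mem fun v _ => AddSubmonoid.nsmul_mem _ (AddSubmonoid.subset_closure
        (Finset.mem_filter.1 v.2).2) _
  refine ⟨hGA, ⟨cone_mono hGA, ?_⟩, ?_⟩
  · rintro x hx y hy z hz ⟨a, b, ha, hb, -, rfl⟩
    obtain ⟨c, hc, hcA, rfl⟩ := exists_coeff_of_mem_cone hA.toFinset (by simp) hx
    obtain ⟨e, he, heA, rfl⟩ := exists_coeff_of_mem_cone hA.toFinset (by simp) hy
    have hsum : ∑ v ∈ hA.toFinset, (a * c v + b * e v) • toR v ∈ cone G := by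
      convert hz using 1
      simp [add_smul, Finset.sum_add_distrib, Finset.smul_sum, mul_smul]
    refine ⟨hA.toFinset.filter (· ∈ G), c, by intro v; simp, hc, ?_⟩
    refine (Finset.sum_subset (Finset.filter_subset _ _) fun v hv hvG => ?_).symm
    have : c v = 0 := by
      by_contra h0
      have hvA : v ∈ A := by simpa using hv
      refine hvG (Finset.mem_filter.2 ⟨hv, key _ (fun w => ?_) hsum v hvA ?_⟩)
      · have := mul_nonneg ha.le (hc w)
        have := mul_nonneg hb.le (he w)
        linarith
      · have := mul_pos ha (lt_of_le_of_ne (hc v) (Ne.symm h0))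
        have := mul_nonneg hb.le (he v)
        linarith
    simp [this]
  · ext y
    constructor
    · rintro ⟨hy, x, hx, rfl⟩
      refine ⟨x, key (fun v => if v = x then 1 else 0) (fun v => ?_) ?_ x hx (by simp), rfl⟩
      · split_ifs <;> norm_num
      · simpa [hx] using hy
    · rintro ⟨x, hx, rfl⟩
      exact ⟨subset_cone hx, x, hGA hx, rfl⟩

end RealCones

section Faces

variable {d : ℕ} {A F G E : Set (Fin d → ℤ)}

theorem NSemi_mono (h : F ⊆ A) : NSemi F ≤ NSemi A := AddSubmonoid.closure_mono h

theorem IsFace.mem_of_add_mem (hF : IsFace A F) {v y : Fin d → ℤ} (hv : v ∈ A)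
    (hy : y ∈ NSemi A) (h : v + y ∈ NSemi F) : v ∈ F := by
  have h1 : (2 : ℝ) • toR v ∈ cone F := by
    refine hF.2.1.left_mem_of_mem_openSegment (smul_mem_cone (by norm_num) (subset_cone hv))
      (smul_mem_cone (r := 2) (by norm_num) (toR_mem_cone_of_mem_NSemi hy))
      (toR_mem_cone_of_mem_NSemi h) ⟨1 / 2, 1 / 2, by norm_num, by norm_num, by norm_num, ?_⟩
    rw [toR_add, smul_smul, smul_smul]
    norm_num
  have h2 : toR v ∈ cone F := by
    have := smul_mem_cone (r := 1 / 2) (by norm_num) h1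
    rw [smul_smul] at this
    norm_num at this
    exact this
  have h3 : toR v ∈ toR '' F := by
    rw [← hF.2.2]
    exact ⟨h2, v, hv, rfl⟩
  obtain ⟨w, hw, hwv⟩ := h3
  rwa [← toR_injective hwv]

theorem IsFace.mem_NSemi_of_add_mem (hF : IsFace A F) {x y : Fin d → ℤ} (hx : x ∈ NSemi A)
    (hy : y ∈ NSemi A) (h : x + y ∈ NSemi F) : x ∈ NSemi F := by
  induction hx using AddSubmonoid.closure_induction generalizing y with
  | mem x hx => exact AddSubmonoid.subset_closure (hF.mem_of_add_mem hx hy h)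
  | zero => exact zero_mem _
  | add a b ha hb iha ihb =>
    refine add_mem (iha (add_mem hb hy) ?_) (ihb (add_mem ha hy) ?_)
    · rwa [← add_assoc]
    · rwa [← add_assoc, add_comm b a]

theorem NSemi_le_ZGrp {x : Fin d → ℤ} (hx : x ∈ NSemi F) : x ∈ ZGrp F :=
  AddSubgroup.le_closure_toAddSubmonoid F hx

theorem exists_of_mem_ZGrp {z : Fin d → ℤ} (hz : z ∈ ZGrp F) :
    ∃ f ∈ NSemi F, ∃ g ∈ NSemi F, z + g = f := by
  induction hz using AddSubgroup.closure_induction with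
  | mem x hx => exact ⟨x, AddSubmonoid.subset_closure hx, 0, zero_mem _, add_zero x⟩
  | zero => exact ⟨0, zero_mem _, 0, zero_mem _, add_zero 0⟩
  | add a b _ _ iha ihb =>
    obtain ⟨f, hf, g, hg, rfl⟩ := iha
    obtain ⟨f', hf', g', hg', rfl⟩ := ihb
    exact ⟨_, add_mem hf hf', _, add_mem hg hg', by abel⟩
  | neg a _ iha =>
    obtain ⟨f, hf, g, hg, rfl⟩ := iha
    exact ⟨g, hg, _, hf, by abel⟩

theorem IsFace.mem_NSemi_of_mem_ZGrp (hF : IsFace A F) {x : Fin d → ℤ} (hx : x ∈ NSemi A)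
    (h : x ∈ ZGrp F) : x ∈ NSemi F := by
  obtain ⟨f, hf, g, hg, rfl⟩ := exists_of_mem_ZGrp h
  exact hF.mem_NSemi_of_add_mem hx (NSemi_mono hF.1 hg) hf

theorem IsFace.mem_of_mem_NSemi (hF : IsFace A F) {v : Fin d → ℤ} (hv : v ∈ A)
    (h : v ∈ NSemi F) : v ∈ F :=
  hF.mem_of_add_mem hv (zero_mem _) (by simpa using h)

theorem IsConfig.eq_zero_of_neg_mem (hA : IsConfig A) {x : Fin d → ℤ} (hx : x ∈ NSemi A)
    (hx' : -x ∈ NSemi A) : x = 0 := by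
  have h := hA.pointed _ (toR_mem_cone_of_mem_NSemi hx) (by
    convert toR_mem_cone_of_mem_NSemi hx' using 1
    ext i
    simp [toR])
  refine toR_injective (h.trans ?_)
  ext i
  simp [toR]

theorem self_mem_cell (a : Fin d → ℤ) : a ∈ cell a F := ⟨0, zero_mem _, (add_zero a).symm⟩

/-- The class of `q` modulo `ℤF` is killed, modulo the monomials with exponents in `E`, by a power
of every monomial `t^v` with `v ∈ A ∖ F`. -/
def IsTors (A F E : Set (Fin d → ℤ)) (q : Fin d → ℤ) : Prop :=
  ∀ v ∈ A, v ∉ F → ∃ n : ℕ, ∃ f ∈ NSemi F, q + n • v + f ∈ E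

theorem IsTors.add (hE : IsExpSet A E) {q c : Fin d → ℤ} (h : IsTors A F E q)
    (hc : c ∈ NSemi A) : IsTors A F E (q + c) := fun v hv hvF => by
  obtain ⟨n, f, hf, hm⟩ := h v hv hvF
  refine ⟨n, f, hf, ?_⟩
  convert hE.2 _ hm c hc using 1
  abel

theorem StdPair.isTors (hA : IsConfig A) (hE : IsExpSet A E) {a : Fin d → ℤ}
    (h : StdPair A E a F) : IsTors A F E a := by
  intro v hv hvF
  by_contra! hcon
  obtain ⟨⟨haA, hF, hcell⟩, hmax⟩ := h
  let G : Set (Fin d → ℤ) := {x | x ∈ A ∧ ∃ y ∈ NSemi A, ∃ n : ℕ, ∃ f ∈ NSemi F, x + y = n • v + f}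
  have hGA : G ⊆ A := fun x hx => hx.1
  have hG : ∀ g ∈ NSemi G, ∃ y ∈ NSemi A, ∃ n : ℕ, ∃ f ∈ NSemi F, g + y = n • v + f := by
    intro g hg
    induction hg using AddSubmonoid.closure_induction with
    | mem x hx => exact hx.2
    | zero => exact ⟨0, zero_mem _, 0, 0, zero_mem _, by simp⟩
    | add a b _ _ iha ihb =>
      obtain ⟨y, hy, n, f, hf, h⟩ := iha
      obtain ⟨y', hy', n', f', hf', h'⟩ := ihb
      refine ⟨_, add_mem hy hy', n + n', _, add_mem hf hf', ?_⟩
      rw [add_add_add_comm, h, h', add_smul]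
      abel
  have hface : IsFace A G := isFace_of_forall_add_mem hA.finite hGA fun x hx y hy hxy => by
    obtain ⟨y', hy', n, f, hf, h⟩ := hG _ hxy
    exact ⟨hx, _, add_mem hy hy', n, f, hf, by rw [← add_assoc, h]⟩
  have hFG : F ⊆ G := fun x hx => ⟨hF.1 hx, 0, zero_mem _, 0, x,
    AddSubmonoid.subset_closure hx, by simp⟩
  have hvG : v ∈ G := ⟨hv, 0, zero_mem _, 1, 0, zero_mem _, by simp⟩
  have hproper : ProperPair A E a G := by
    refine ⟨haA, hface, ?_⟩
    rintro _ ⟨g, hg, rfl⟩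
    refine ⟨add_mem haA (NSemi_mono hGA hg), fun hmem => ?_⟩
    obtain ⟨y, hy, n, f, hf, h⟩ := hG g hg
    refine hcon n f hf ?_
    rw [add_assoc, ← h, ← add_assoc]
    exact hE.2 _ hmem _ hy
  have hsub : cell a F ⊆ cell a G := by
    rintro _ ⟨f, hf, rfl⟩
    exact ⟨f, NSemi_mono hFG hf, rfl⟩
  obtain ⟨f, hf, hvf⟩ := hmax a G hproper hsub ⟨v, AddSubmonoid.subset_closure hvG, rfl⟩
  rw [add_right_inj] at hvf
  exact hvF (hF.mem_of_mem_NSemi hv (hvf ▸ hf))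

theorem StdPair.add_notMem {a f : Fin d → ℤ} (h : StdPair A E a F) (hf : f ∈ NSemi F) :
    a + f ∉ E :=
  (h.1.2.2 ⟨f, hf, rfl⟩).2

theorem mem_of_sub_mem_ZGrp (hE : IsExpSet A E) (hFA : F ⊆ A) {p q : Fin d → ℤ}
    (h : p - q ∈ ZGrp F) (hq : ∃ f ∈ NSemi F, q + f ∈ E) : ∃ f ∈ NSemi F, p + f ∈ E := by
  obtain ⟨f, hf, hm⟩ := hq
  obtain ⟨g, hg, g', hg', hgg⟩ := exists_of_mem_ZGrp h
  refine ⟨f + g', add_mem hf hg', ?_⟩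
  have : p + (f + g') = q + f + g := by rw [← hgg]; abel
  rw [this]
  exact hE.2 _ hm _ (NSemi_mono hFA hg)

/-- Divisibility is well-founded on `ℕA`: every nonempty subset has an element which is not a proper
multiple of another one. -/
theorem IsConfig.exists_minimal (hA : IsConfig A) {T : Set (Fin d → ℤ)} (hT : T ⊆ NSemi A)
    (hne : T.Nonempty) : ∃ b ∈ T, ∀ c ∈ T, ∀ q ∈ NSemi A, b = c + q → b = c := by
  have hfg : AddMonoid.FG (NSemi A) :=
    (AddMonoid.fg_iff_addSubmonoid_fg _).2 ((AddSubmonoid.fg_iff _).2 ⟨A, rfl, hA.finite⟩)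
  have : IsNoetherianRing (AddMonoidAlgebra ℚ (NSemi A)) :=
    Algebra.FiniteType.isNoetherianRing ℚ _
  let J : T → Ideal (AddMonoidAlgebra ℚ (NSemi A)) := fun b =>
    Ideal.span (AddMonoidAlgebra.of' ℚ (NSemi A) '' {⟨b, hT b.2⟩})
  obtain ⟨b, hb⟩ := hne
  obtain ⟨_, ⟨b, rfl⟩, hmax⟩ := WellFounded.has_min (wellFounded_gt (α := Ideal _))
    (Set.range J) ⟨_, ⟨b, hb⟩, rfl⟩
  refine ⟨b, b.2, fun c hc q hq hbc => ?_⟩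
  have hle : J b ≤ J ⟨c, hc⟩ := by
    refine Ideal.span_le.2 ?_
    rintro _ ⟨_, rfl, rfl⟩
    refine AddMonoidAlgebra.mem_ideal_span_of'_image.2 fun m hm => ⟨_, rfl, ⟨q, hq⟩, ?_⟩
    have : m = ⟨b, hT b.2⟩ := by simpa [AddMonoidAlgebra.of'] using hm
    rw [this]
    exact Subtype.ext (hbc.trans (add_comm _ _))
  have heq : J b = J ⟨c, hc⟩ := by
    by_contra hne
    exact hmax _ ⟨_, rfl⟩ (lt_of_le_of_ne hle hne)
  have hmem : AddMonoidAlgebra.of' ℚ (NSemi A) ⟨c, hT hc⟩ ∈ J b :=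
    heq ▸ Ideal.subset_span ⟨_, rfl, rfl⟩
  obtain ⟨_, rfl, r, hr⟩ := AddMonoidAlgebra.mem_ideal_span_of'_image.1 hmem ⟨c, hT hc⟩
    (by simp [AddMonoidAlgebra.of'])
  have hr' : c = r + b := congrArg Subtype.val hr
  have hqr : -q = r := by
    rw [hbc, ← add_assoc, add_right_comm] at hr'
    have : r + q = 0 := by simpa using hr'
    rw [eq_comm, ← add_eq_zero_iff_eq_neg, this]
  have : q = 0 := hA.eq_zero_of_neg_mem hq (hqr ▸ r.2)
  rw [hbc, this, add_zero]

theorem IsTors.exists_stdPair (hA : IsConfig A) (hE : IsExpSet A E) (hF : IsFace A F)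
    {q : Fin d → ℤ} (hq : q ∈ NSemi A) (h : IsTors A F E q) :
    (∃ f ∈ NSemi F, q + f ∈ E) ∨ ∃ b, StdPair A E b F ∧ b - q ∈ ZGrp F := by
  by_cases hqE : ∃ f ∈ NSemi F, q + f ∈ E
  · exact .inl hqE
  right
  obtain ⟨b, ⟨hbA, hbq⟩, hmin⟩ := hA.exists_minimal (T := {b | b ∈ NSemi A ∧ b - q ∈ ZGrp F})
    (fun _ hb => hb.1) ⟨q, hq, by simp⟩
  have hbE : ∀ f ∈ NSemi F, b + f ∉ E := fun f hf hm =>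
    hqE (mem_of_sub_mem_ZGrp hE hF.1 (by simpa using neg_mem hbq) ⟨f, hf, hm⟩)
  refine ⟨b, ⟨⟨hbA, hF, ?_⟩, ?_⟩, hbq⟩
  · rintro _ ⟨f, hf, rfl⟩
    exact ⟨add_mem hbA (NSemi_mono hF.1 hf), hbE f hf⟩
  intro c G hc hsub
  obtain ⟨g, hg, hbc⟩ := hsub (self_mem_cell b)
  have hG := hc.2.1
  have hFG : F ⊆ G := by
    intro f hf
    obtain ⟨g', hg', h'⟩ := hsub ⟨f, AddSubmonoid.subset_closure hf, rfl⟩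
    refine hG.mem_of_add_mem (hF.1 hf) (NSemi_mono hG.1 hg) ?_
    have : f + g = g' := by
      rw [hbc, add_assoc, add_right_inj] at h'
      rw [← h', add_comm]
    rwa [this]
  have hGF : G ⊆ F := by
    intro v hv
    by_contra hvF
    obtain ⟨n, f, hf, hm⟩ := h v (hG.1 hv) hvF
    have hbn : ∃ f ∈ NSemi F, b + n • v + f ∈ E :=
      mem_of_sub_mem_ZGrp hE hF.1 (q := q + n • v) (by simpa using hbq) ⟨f, hf, hm⟩
    obtain ⟨f', hf', hm'⟩ := hbn
    refine (hc.2.2 ⟨g + n • v + f', ?_, ?_⟩).2 hm'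
    · exact add_mem (add_mem hg (AddSubmonoid.nsmul_mem _ (AddSubmonoid.subset_closure hv) _))
        (NSemi_mono hFG hf')
    · rw [hbc]
      abel
  obtain rfl : F = G := hFG.antisymm hGF
  have hcb : b = c := by
    refine hmin c ⟨hc.1, ?_⟩ g (NSemi_mono hF.1 hg) hbc
    have : c - q = (b - q) - g := by
      rw [hbc]
      abel
    rw [this]
    exact sub_mem hbq (NSemi_le_ZGrp hg)
  rw [hcb]

/-- Every element of `ℕA` is, modulo `ℤF`, a natural combination of elements of `A ∖ F`. -/
theorem exists_coeff_mod_ZGrp (hA : A.Finite) {q : Fin d → ℤ} (hq : q ∈ NSemi A) :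
    ∃ n : hA.toFinset → ℕ, (∀ v : hA.toFinset, (v : Fin d → ℤ) ∈ F → n v = 0) ∧
      q - ∑ v, n v • (v : Fin d → ℤ) ∈ ZGrp F := by
  classical
  induction hq using AddSubmonoid.closure_induction with
  | mem x hx =>
    by_cases hxF : x ∈ F
    · exact ⟨0, by simp, by simpa using NSemi_le_ZGrp (AddSubmonoid.subset_closure hxF)⟩
    · refine ⟨Pi.single ⟨x, by simpa using hx⟩ 1, fun v hv => ?_, ?_⟩
      · rw [Pi.single_eq_of_ne]
        rintro rfl
        exact hxF hv
      · rw [Finset.sum_eq_single ⟨x, by simpa using hx⟩]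
        · simp
        · intro v _ hv
          simp [hv]
        · simp
  | zero => exact ⟨0, by simp, by simp⟩
  | add a b _ _ iha ihb =>
    obtain ⟨n, hn, h⟩ := iha
    obtain ⟨n', hn', h'⟩ := ihb
    refine ⟨n + n', fun v hv => by simp [hn v hv, hn' v hv], ?_⟩
    convert add_mem h h' using 1
    simp only [Pi.add_apply, add_smul, Finset.sum_add_distrib]
    abel

/-- The overlap classes of standard pairs belonging to a face. -/
abbrev OverlapClass (A E F : Set (Fin d → ℤ)) :=
  Quot (fun x y : {a : Fin d → ℤ // StdPair A E a F} => Overlap F x.1 y.1)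

theorem overlapClass_eq_iff {x y : {a : Fin d → ℤ // StdPair A E a F}} :
    (Quot.mk _ x : OverlapClass A E F) = Quot.mk _ y ↔ x.1 - y.1 ∈ ZGrp F := by
  have hequiv : Equivalence
      (fun x y : {a : Fin d → ℤ // StdPair A E a F} => Overlap F x.1 y.1) :=
    ⟨fun x => by simp [Overlap], fun {x y} h => by simpa [Overlap] using neg_mem h,
      fun {x y z} h h' => by simpa [Overlap] using add_mem h h'⟩
  rw [Quot.eq, hequiv.eqvGen_iff]
  rfl

theorem overlapClass_finite (hA : IsConfig A) (hE : IsExpSet A E) :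
    Finite (OverlapClass A E F) := by
  by_contra hinf
  rw [not_finite_iff_infinite] at hinf
  let a : OverlapClass A E F → Fin d → ℤ := fun i => i.out.1
  have ha : ∀ i, StdPair A E (a i) F := fun i => i.out.2
  have hinj : ∀ i j, a i - a j ∈ ZGrp F → i = j := fun i j h => by
    rw [← Quot.out_eq i, ← Quot.out_eq j]
    exact overlapClass_eq_iff.2 h
  choose n hnF hn using fun i => exists_coeff_mod_ZGrp (F := F) hA.finite (ha i).1.1
  have hninj : Function.Injective n := fun i j hij => hinj i j (by
    have := sub_mem (hn i) (hn j)
    rwa [hij, sub_sub_sub_cancel_right] at this)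
  let e := Infinite.natEmbedding (OverlapClass A E F)
  obtain ⟨g, hg⟩ := (Set.isPWO_of_wellQuasiOrderedLE
    (Set.univ : Set (hA.finite.toFinset → ℕ))).exists_monotone_subseq
    (f := fun k => n (e k)) (fun _ => Set.mem_univ _)
  set i₀ := e (g 0)
  have htors := (ha i₀).isTors hA hE
  have hbound : ∀ v : hA.finite.toFinset, ∃ N : ℕ, ∀ k, n (e (g k)) v ≤ N := by
    intro v
    by_cases hvF : (v : Fin d → ℤ) ∈ F
    · exact ⟨0, fun k => (hnF _ v hvF).le⟩
    obtain ⟨N, f, hf, hm⟩ := htors v (hA.finite.mem_toFinset.1 v.2) hvF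
    refine ⟨n i₀ v + N, fun k => ?_⟩
    by_contra! hlt
    have hle : n i₀ ≤ n (e (g k)) := hg (Nat.zero_le k)
    have hsum : ∑ w, n (e (g k)) w • (w : Fin d → ℤ) = ∑ w, n i₀ w • (w : Fin d → ℤ) +
        (N • (v : Fin d → ℤ) + ∑ w, (n (e (g k)) w - n i₀ w -
          (if w = v then N else 0)) • (w : Fin d → ℤ)) := by
      have : N • (v : Fin d → ℤ) = ∑ w, (if w = v then N else 0) • (w : Fin d → ℤ) := by
        simp
      rw [this, ← Finset.sum_add_distrib, ← Finset.sum_add_distrib]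
      refine Finset.sum_congr rfl fun w _ => ?_
      rw [← add_smul, ← add_smul]
      congr 1
      have : n i₀ w ≤ n (e (g k)) w := hle w
      split_ifs with hw
      · subst hw
        omega
      · omega
    have hmem : ∑ w, (n (e (g k)) w - n i₀ w -
        (if w = v then N else 0)) • (w : Fin d → ℤ) ∈ NSemi A :=
      sum_mem fun w _ => AddSubmonoid.nsmul_mem _
        (AddSubmonoid.subset_closure (hA.finite.mem_toFinset.1 w.2)) _
    have hE1 := hE.2 _ hm _ hmem
    obtain ⟨f', hf', hm'⟩ := mem_of_sub_mem_ZGrp hE (ha i₀).1.2.1.1 (p := a (e (g k)))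
      (q := a i₀ + N • (v : Fin d → ℤ) + ∑ w, (n (e (g k)) w - n i₀ w -
        (if w = v then N else 0)) • (w : Fin d → ℤ)) (by
      convert sub_mem (hn (e (g k))) (hn i₀) using 1
      rw [hsum]
      abel) ⟨f, hf, by convert hE1 using 1; exact add_right_comm (a i₀ + N • (v : Fin d → ℤ)) _ f⟩
    exact (ha _).add_notMem hf' hm'
  choose N hN using hbound
  have hfin : (Set.range fun k => n (e (g k))).Finite :=
    (Set.finite_Iic N).subset (by rintro _ ⟨k, rfl⟩; exact fun v => hN v k)
  exact Set.infinite_range_of_injective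
    (hninj.comp (e.injective.comp g.injective)) hfin

end Faces

section Order

/-- A partial order on a finite type can be refined to an enumeration. -/
theorem exists_equiv_fin {ι : Type*} [Finite ι] (r : ι → ι → Prop) (hrefl : ∀ i, r i i)
    (htrans : ∀ i j l, r i j → r j l → r i l) (hanti : ∀ i j, r i j → r j i → i = j) :
    ∃ e : Fin (Nat.card ι) ≃ ι, ∀ i j, r (e i) (e j) → i ≤ j := by
  let : PartialOrder ι :=
    { le := r, le_refl := hrefl, le_trans := htrans, le_antisymm := hanti }
  let : Fintype (LinearExtension ι) := @Fintype.ofFinite ι _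
  let e := monoEquivOfFin (LinearExtension ι) (k := Nat.card ι) Nat.card_eq_fintype_card.symm
  refine ⟨e.toEquiv, fun i j hij => ?_⟩
  have h : toLinearExtension (α := ι) (e i) ≤ toLinearExtension (α := ι) (e j) :=
    (toLinearExtension (α := ι)).monotone hij
  exact e.le_iff_le.1 h

theorem exists_minimal_of_trans {α : Type*} (D : Finset α) (hD : D.Nonempty)
    (r : α → α → Prop) (htrans : ∀ i j l, r i j → r j l → r i l) :
    ∃ c ∈ D, ∀ q ∈ D, r q c → r c q := by
  let r' : D → D → Prop := fun x y => r x y ∧ ¬ r y x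
  have h1 : IsTrans D r' := ⟨fun x y z h h' =>
    ⟨htrans _ _ _ h.1 h'.1, fun h'' => h.2 (htrans _ _ _ h'.1 h'')⟩⟩
  have h2 : Std.Irrefl r' := ⟨fun x h => h.2 h.1⟩
  obtain ⟨c, -, hc⟩ := (Finite.wellFounded_of_trans_of_irrefl r').has_min Set.univ
    ⟨⟨_, hD.choose_spec⟩, trivial⟩
  refine ⟨c, c.2, fun q hq hqc => ?_⟩
  by_contra h
  exact hc ⟨q, hq⟩ trivial ⟨hqc, h⟩

variable {d : ℕ} {A F : Set (Fin d → ℤ)}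

/-- Divisibility in `ℕA` modulo `ℤF`. -/
def DvdMod (A F : Set (Fin d → ℤ)) (p q : Fin d → ℤ) : Prop :=
  ∃ w ∈ NSemi A, q - p - w ∈ ZGrp F

theorem DvdMod.of_sub_mem {p q : Fin d → ℤ} (h : q - p ∈ ZGrp F) : DvdMod A F p q :=
  ⟨0, zero_mem _, by simpa using h⟩

theorem DvdMod.trans {p q r : Fin d → ℤ} (h : DvdMod A F p q) (h' : DvdMod A F q r) :
    DvdMod A F p r := by
  obtain ⟨w, hw, h⟩ := h
  obtain ⟨w', hw', h'⟩ := h'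
  refine ⟨w + w', add_mem hw hw', ?_⟩
  convert add_mem h h' using 1
  abel

theorem DvdMod.antisymm (hF : IsFace A F) {p q : Fin d → ℤ} (h : DvdMod A F p q)
    (h' : DvdMod A F q p) : p - q ∈ ZGrp F := by
  obtain ⟨w, hw, h⟩ := h
  obtain ⟨w', hw', h'⟩ := h'
  have hww : w + w' ∈ ZGrp F := by
    convert neg_mem (add_mem h h') using 1
    abel
  have hw'F : w' ∈ ZGrp F := by
    rw [add_comm] at hww
    exact NSemi_le_ZGrp (hF.mem_NSemi_of_add_mem hw' hw
      (hF.mem_NSemi_of_mem_ZGrp (add_mem hw' hw) hww))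
  convert add_mem h' hw'F using 1
  abel

end Order

section CompositionSeries

variable {R M : Type*} [CommRing R] [IsLocalRing R] [AddCommGroup M] [Module R M]

theorem exists_compositionSeries_of_span_eq_top {n : ℕ} (x : Fin n → M)
    (hspan : Submodule.span R (Set.range x) = ⊤)
    (hmul : ∀ r ∈ IsLocalRing.maximalIdeal R, ∀ i, r • x i ∈ Submodule.span R (x '' Set.Iio i))
    (hnot : ∀ i, x i ∉ Submodule.span R (x '' Set.Iio i)) :
    ∃ s : CompositionSeries (Submodule R M), s.head = ⊥ ∧ s.last = ⊤ ∧ s.length = n := by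
  let K : Fin (n + 1) → Submodule R M := fun i =>
    Submodule.span R (x '' {j | j.castSucc < i})
  have hK : ∀ i : Fin n, K i.castSucc = Submodule.span R (x '' Set.Iio i) := fun i => by
    simp [K, Set.Iio]
  have hK' : ∀ i : Fin n, K i.succ = K i.castSucc ⊔ Submodule.span R {x i} := fun i => by
    have : {j : Fin n | j.castSucc < i.succ} = Set.Iio i ∪ {i} := by
      ext j
      simp [le_iff_lt_or_eq, or_comm]
    rw [hK, ← Submodule.span_union, ← Set.image_singleton, ← Set.image_union, ← this]
  refine ⟨⟨n, K, fun i => ?_⟩, ?_, ?_, rfl⟩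
  · change K i.castSucc ⋖ K i.succ
    refine ⟨lt_of_le_of_ne (by rw [hK']; exact le_sup_left) fun h => ?_, fun L hL hL' => ?_⟩
    · refine hnot i ?_
      rw [← hK, h, hK']
      exact Submodule.mem_sup_right (Submodule.mem_span_singleton_self _)
    · obtain ⟨y, hyL, hyK⟩ := SetLike.exists_of_lt hL
      have hy := hL'.le hyL
      rw [hK'] at hy
      obtain ⟨z, hz, w, hw, rfl⟩ := Submodule.mem_sup.1 hy
      obtain ⟨r, rfl⟩ := Submodule.mem_span_singleton.1 hw
      have hr : IsUnit r := by
        by_contra hr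
        refine hyK (add_mem hz ?_)
        rw [hK]
        exact hmul r ((IsLocalRing.mem_maximalIdeal r).2 hr) i
      have hxL : x i ∈ L := by
        have : r • x i ∈ L := by
          simpa using sub_mem hyL (hL.le hz)
        rwa [Submodule.smul_mem_iff_of_isUnit _ hr] at this
      refine hL'.not_ge ?_
      rw [hK']
      exact sup_le hL.le ((Submodule.span_singleton_le_iff_mem _ _).2 hxL)
  · change K 0 = ⊥
    simp [K]
  · change K (Fin.last n) = ⊤
    simp [K, Fin.castSucc_lt_last, hspan]

theorem exists_compositionSeries {n : ℕ} (x : Fin n → M) (N : Submodule R M)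
    (hspan : N = Submodule.span R (Set.range x))
    (hmul : ∀ r ∈ IsLocalRing.maximalIdeal R, ∀ i, r • x i ∈ Submodule.span R (x '' Set.Iio i))
    (hnot : ∀ i, x i ∉ Submodule.span R (x '' Set.Iio i)) :
    ∃ s : CompositionSeries (Submodule R N), s.head = ⊥ ∧ s.last = ⊤ ∧ s.length = n := by
  have hxN : ∀ i, x i ∈ N := fun i => hspan ▸ Submodule.subset_span ⟨i, rfl⟩
  let y : Fin n → N := fun i => ⟨x i, hxN i⟩
  have hy : ∀ (s : Set (Fin n)) (z : N),
      z ∈ Submodule.span R (y '' s) ↔ (z : M) ∈ Submodule.span R (x '' s) := fun s z => by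
    have : x '' s = N.subtype '' (y '' s) := by
      rw [Set.image_image]
      rfl
    rw [this, Submodule.span_image]
    simp
  refine exists_compositionSeries_of_span_eq_top y ?_ (fun r hr i => (hy _ _).2 (hmul r hr i))
    (fun i h => hnot i ((hy _ _).1 h))
  rw [eq_top_iff]
  rintro z -
  rw [← Set.image_univ, hy, Set.image_univ, ← hspan]
  exact z.2

end CompositionSeries

section Localization

variable {d : ℕ} {k : Type*} [Field k] {A F : Set (Fin d → ℤ)}

theorem mem_span_mono_iff {T : Set (NSemi A)} {s : SGRing k A} :
    s ∈ Ideal.span (mono k A '' T) ↔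
      ∀ m ∈ s.coeff.support, ∃ t ∈ T, ∃ r : NSemi A, m = r + t :=
  AddMonoidAlgebra.mem_ideal_span_of'_image

theorem mono_add (a b : NSemi A) : mono k A (a + b) = mono k A a * mono k A b := by
  simp [mono, AddMonoidAlgebra.single_mul_single]

theorem mono_pow (a : NSemi A) (n : ℕ) : mono k A a ^ n = mono k A (n • a) := by
  simp [mono, AddMonoidAlgebra.single_pow]

theorem support_mono (a : NSemi A) : (mono k A a).coeff.support = {a} := by
  simp [mono]

theorem mem_primeF_iff (hF : IsFace A F) {s : SGRing k A} :
    s ∈ primeF k A F ↔ ∀ m ∈ s.coeff.support, (m : Fin d → ℤ) ∉ NSemi F := by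
  have : primeF k A F = Ideal.span (mono k A '' {a | (a : Fin d → ℤ) ∉ NSemi F}) := by
    unfold primeF
    congr 1
    ext x
    simp only [Set.mem_ofPred_eq, Set.mem_image, eq_comm]
  rw [this, mem_span_mono_iff]
  refine forall₂_congr fun m _ => ⟨?_, fun h => ⟨m, h, 0, by simp⟩⟩
  rintro ⟨t, ht, r, rfl⟩ hm
  refine ht (hF.mem_NSemi_of_add_mem t.2 r.2 ?_)
  rwa [add_comm]

theorem mono_notMem_primeF (hF : IsFace A F) {f : NSemi A} (hf : (f : Fin d → ℤ) ∈ NSemi F) :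
    mono k A f ∉ primeF k A F := fun h =>
  (mem_primeF_iff hF).1 h f (by simp [support_mono]) hf

/-- `t^q` lies, up to a monomial `t^f` with `f ∈ ℕF`, in the ideal generated by the monomials with
exponents in `T`. -/
def LocMem (F : Set (Fin d → ℤ)) (T : Set (NSemi A)) (q : Fin d → ℤ) : Prop :=
  ∃ f ∈ NSemi F, ∃ t ∈ T, ∃ r ∈ NSemi A, q + f = r + t

theorem LocMem.of_add_eq {T : Set (NSemi A)} {q q' f w : Fin d → ℤ} (h : LocMem F T q)
    (hf : f ∈ NSemi F) (hw : w ∈ NSemi A) (heq : q' + f = q + w) : LocMem F T q' := by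
  obtain ⟨f', hf', t, ht, r, hr, h⟩ := h
  refine ⟨f + f', add_mem hf hf', t, ht, _, add_mem hr hw, ?_⟩
  rw [← add_assoc, heq, add_right_comm, h]
  abel

theorem locMem_of_mul_mem (hF : IsFace A F) {T : Set (NSemi A)} {u s : SGRing k A}
    (hu : u ∉ primeF k A F) (h : u * s ∈ Ideal.span (mono k A '' T)) {m : NSemi A}
    (hm : m ∈ s.coeff.support) : LocMem F T m := by
  classical
  have huniq : UniqueSums (NSemi A) :=
    UniqueSums.of_injective_addHom (NSemi A).subtype.toAddHom Subtype.val_injective inferInstance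
  by_contra hmT
  let D := s.coeff.support.filter fun q : NSemi A => ¬ LocMem F T (q : Fin d → ℤ)
  obtain ⟨c, hcD, hc⟩ := exists_minimal_of_trans D ⟨m, by simp [D, hmT, hm]⟩
    (fun p q : NSemi A => DvdMod A F p q) (fun _ _ _ h h' => h.trans h')
  let Dc := D.filter fun q : NSemi A => (c : Fin d → ℤ) - q ∈ ZGrp F
  let U := u.coeff.support.filter fun q : NSemi A => (q : Fin d → ℤ) ∈ NSemi F
  have hU : U.Nonempty := by
    rw [mem_primeF_iff hF] at hu
    push Not at hu
    obtain ⟨f, hf, hfF⟩ := hu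
    exact ⟨f, by simp only [U, Finset.mem_filter]; exact ⟨hf, hfF⟩⟩
  have hDc : Dc.Nonempty := ⟨c, by simp only [Dc, Finset.mem_filter]; exact ⟨hcD, by simp⟩⟩
  obtain ⟨f, hf, q, hq, hfq⟩ := huniq.uniqueAdd_of_nonempty hU hDc
  obtain ⟨hfu, hfF⟩ := Finset.mem_filter.1 hf
  obtain ⟨hqD, hcq⟩ := Finset.mem_filter.1 hq
  obtain ⟨hqs, hqT⟩ := Finset.mem_filter.1 hqD
  have hun : UniqueAdd u.coeff.support s.coeff.support f q := by
    intro f' q' hf' hq' heq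
    have heqv : (f' : Fin d → ℤ) + q' = f + q := congrArg Subtype.val heq
    have hq'D : q' ∈ D := Finset.mem_filter.2 ⟨hq', fun hloc =>
      hqT (hloc.of_add_eq hfF f'.2 (by rw [add_comm, ← heqv, add_comm]))⟩
    have hcq'f : (c : Fin d → ℤ) - q' - f' ∈ ZGrp F := by
      have : (c : Fin d → ℤ) - q' - f' = (c - q) - f := by
        rw [sub_sub, sub_sub, add_comm (q' : Fin d → ℤ), heqv, add_comm (q : Fin d → ℤ)]
      rw [this]
      exact sub_mem hcq (NSemi_le_ZGrp hfF)
    have hdvd : DvdMod A F q' c := ⟨f', f'.2, hcq'f⟩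
    have hcq' := (hc q' hq'D hdvd).antisymm hF hdvd
    have hf'F : (f' : Fin d → ℤ) ∈ NSemi F := hF.mem_NSemi_of_mem_ZGrp f'.2 (by
      convert sub_mem hcq' hcq'f using 1
      abel)
    exact hfq (Finset.mem_filter.2 ⟨hf', hf'F⟩) (Finset.mem_filter.2 ⟨hq'D, hcq'⟩) heq
  have hmem : f + q ∈ (u * s).coeff.support := by
    rw [Finsupp.mem_support_iff, AddMonoidAlgebra.coeff_mul_add_of_uniqueAdd hun]
    exact mul_ne_zero (Finsupp.mem_support_iff.1 hfu) (Finsupp.mem_support_iff.1 hqs)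
  obtain ⟨t, ht, r, hr⟩ := mem_span_mono_iff.1 h _ hmem
  refine hqT ⟨f, hfF, t, ht, r, r.2, ?_⟩
  rw [add_comm]
  exact congrArg Subtype.val hr

variable [hP : (primeF k A F).IsPrime]

theorem isUnit_algebraMap_mono (hF : IsFace A F) {f : NSemi A}
    (hf : (f : Fin d → ℤ) ∈ NSemi F) :
    IsUnit (algebraMap (SGRing k A) (Localization.AtPrime (primeF k A F)) (mono k A f)) :=
  IsLocalization.map_units (M := (primeF k A F).primeCompl) _ ⟨_, mono_notMem_primeF hF hf⟩

theorem algebraMap_mem_map_span_mono_iff (hF : IsFace A F) {T : Set (NSemi A)}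
    {s : SGRing k A} :
    algebraMap (SGRing k A) (Localization.AtPrime (primeF k A F)) s ∈
        (Ideal.span (mono k A '' T)).map
          (algebraMap (SGRing k A) (Localization.AtPrime (primeF k A F))) ↔
      ∀ m ∈ s.coeff.support, LocMem F T (m : Fin d → ℤ) := by
  constructor
  · rw [IsLocalization.algebraMap_mem_map_algebraMap_iff (primeF k A F).primeCompl]
    rintro ⟨u, hu, hmem⟩ m hm
    exact locMem_of_mul_mem hF hu hmem hm
  · intro h
    rw [← s.sum_coeff_single, Finsupp.sum, map_sum]
    refine Ideal.sum_mem _ fun m hm => ?_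
    obtain ⟨f, hf, t, ht, r, hr, heq⟩ := h m hm
    lift f to NSemi A using NSemi_mono hF.1 hf
    lift r to NSemi A using hr
    rw [← Ideal.unit_mul_mem_iff_mem _ (isUnit_algebraMap_mono hF hf), ← map_mul]
    refine Ideal.mem_map_of_mem _ ?_
    have : mono k A f * AddMonoidAlgebra.single m (s.coeff m) =
        AddMonoidAlgebra.single r (s.coeff m) * mono k A t := by
      have h' : m + f = r + t := Subtype.ext heq
      simp [mono, AddMonoidAlgebra.single_mul_single, ← h', add_comm]
    rw [this]
    exact Ideal.mul_mem_left _ _ (Ideal.subset_span ⟨t, ht, rfl⟩)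

end Localization

section MonomialIdeal

variable {d : ℕ} {k : Type*} [Field k] {A F : Set (Fin d → ℤ)} {I : Ideal (SGRing k A)}

theorem isExpSet_expSet (I : Ideal (SGRing k A)) : IsExpSet A (expSet k A I) := by
  refine ⟨fun x hx => hx.1, ?_⟩
  rintro e ⟨he, hmem⟩ c hc
  refine ⟨add_mem he hc, ?_⟩
  have : mono k A ⟨e + c, add_mem he hc⟩ = mono k A ⟨e, he⟩ * mono k A ⟨c, hc⟩ :=
    mono_add ⟨e, he⟩ ⟨c, hc⟩
  rw [this]
  exact Ideal.mul_mem_right _ _ hmem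

theorem IsMonomialIdeal.eq_span (hI : IsMonomialIdeal k A I) :
    I = Ideal.span (mono k A '' {t | (t : Fin d → ℤ) ∈ expSet k A I}) := by
  refine le_antisymm ?_ (Ideal.span_le.2 ?_)
  · obtain ⟨S, hS⟩ := hI
    conv_lhs => rw [hS]
    refine Ideal.span_mono (Set.image_mono fun a ha => ⟨a.2, ?_⟩)
    rw [hS]
    exact Ideal.subset_span ⟨a, ha, rfl⟩
  · rintro _ ⟨t, ⟨_, ht⟩, rfl⟩
    exact ht

theorem locMem_iff {E : Set (Fin d → ℤ)} (hE : IsExpSet A E) {q : Fin d → ℤ} :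
    LocMem F {t : NSemi A | (t : Fin d → ℤ) ∈ E} q ↔ ∃ f ∈ NSemi F, q + f ∈ E := by
  constructor
  · rintro ⟨f, hf, t, ht, r, hr, h⟩
    refine ⟨f, hf, ?_⟩
    rw [h, add_comm]
    exact hE.2 _ ht _ hr
  · rintro ⟨f, hf, h⟩
    exact ⟨f, hf, ⟨_, hE.1 h⟩, h, 0, zero_mem _, (zero_add _).symm⟩

theorem IsConfig.isNoetherianRing (hA : IsConfig A) (k : Type*) [Field k] :
    IsNoetherianRing (SGRing k A) := by
  have : AddMonoid.FG (NSemi A) :=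
    (AddMonoid.fg_iff_addSubmonoid_fg _).2 ((AddSubmonoid.fg_iff _).2 ⟨A, rfl, hA.finite⟩)
  exact Algebra.FiniteType.isNoetherianRing k _

/-- An ideal containing the images of all `t^v` with `v ∈ A ∖ F` contains the images of all
monomials `t^a` with `a ∉ ℕF`. -/
theorem mono_mem_of_forall_generator {B : Type*} [CommRing B] (φ : SGRing k A →+* B) (J : Ideal B)
    (h : ∀ v : NSemi A, (v : Fin d → ℤ) ∈ A → (v : Fin d → ℤ) ∉ F → φ (mono k A v) ∈ J)
    {a : Fin d → ℤ} (ha : a ∈ NSemi A) (haF : a ∉ NSemi F) : φ (mono k A ⟨a, ha⟩) ∈ J := by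
  induction ha using AddSubmonoid.closure_induction with
  | mem x hx => exact h ⟨x, _⟩ hx fun hxF => haF (AddSubmonoid.subset_closure hxF)
  | zero => exact absurd (zero_mem _) haF
  | add a b ha hb iha ihb =>
    have heq : mono k A ⟨a + b, add_mem ha hb⟩ = mono k A ⟨a, ha⟩ * mono k A ⟨b, hb⟩ :=
      mono_add ⟨a, ha⟩ ⟨b, hb⟩
    rw [heq, map_mul]
    by_cases h1 : a ∈ NSemi F
    · exact Ideal.mul_mem_left _ _ (ihb fun h2 => haF (add_mem h1 h2))
    · exact Ideal.mul_mem_right _ _ (iha h1)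

variable (k I) in
/-- The exponent of a monomial representing an overlap class of standard pairs. -/
noncomputable def OverlapClass.exponent (i : OverlapClass A (expSet k A I) F) : NSemi A :=
  ⟨i.out.1, i.out.2.1.1⟩

theorem OverlapClass.exponent_sub_mem {i : OverlapClass A (expSet k A I) F} {b : Fin d → ℤ}
    (hb : StdPair A (expSet k A I) b F) (h : Quot.mk _ ⟨b, hb⟩ = i) :
    (OverlapClass.exponent k I i : Fin d → ℤ) - b ∈ ZGrp F :=
  overlapClass_eq_iff.1 ((Quot.out_eq i).trans h.symm)

theorem exists_overlapClass_enumeration (hA : IsConfig A) (hF : IsFace A F)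
    (I : Ideal (SGRing k A)) :
    ∃ e : Fin (Nat.card (OverlapClass A (expSet k A I) F)) ≃ OverlapClass A (expSet k A I) F,
      ∀ i j, DvdMod A F (OverlapClass.exponent k I (e j) : Fin d → ℤ)
        (OverlapClass.exponent k I (e i)) → i ≤ j := by
  have := overlapClass_finite (F := F) hA (isExpSet_expSet I)
  refine exists_equiv_fin (fun i j => DvdMod A F (OverlapClass.exponent k I j : Fin d → ℤ)
    (OverlapClass.exponent k I i)) (fun i => .of_sub_mem (by simp))
    (fun i j l h h' => h'.trans h) fun i j h h' => ?_
  rw [← Quot.out_eq i, ← Quot.out_eq j]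
  exact overlapClass_eq_iff.2 (h'.antisymm hF h)

variable [hP : (primeF k A F).IsPrime]

variable (k A F I) in
/-- The image of an element of `k[ℕA]` in the localization of `k[ℕA]/I` at `p_F`. -/
noncomputable def toLocQuot (s : SGRing k A) : Localization.AtPrime (primeF k A F) ⧸
    I.map (algebraMap (SGRing k A) (Localization.AtPrime (primeF k A F))) :=
  Ideal.Quotient.mk _ (algebraMap _ _ s)

theorem smul_toLocQuot (r s : SGRing k A) :
    algebraMap (SGRing k A) (Localization.AtPrime (primeF k A F)) r • toLocQuot k A F I s =
      toLocQuot k A F I (r * s) := by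
  simp only [toLocQuot, map_mul]
  rfl

theorem toLocQuot_mem_of_forall_mono {s : SGRing k A}
    {K : Submodule (Localization.AtPrime (primeF k A F)) (Localization.AtPrime (primeF k A F) ⧸
      I.map (algebraMap (SGRing k A) (Localization.AtPrime (primeF k A F))))}
    (h : ∀ m ∈ s.coeff.support, toLocQuot k A F I (mono k A m) ∈ K) :
    toLocQuot k A F I s ∈ K := by
  rw [← s.sum_coeff_single, Finsupp.sum, toLocQuot, map_sum, map_sum]
  refine sum_mem fun m hm => ?_
  have heq : AddMonoidAlgebra.single m (s.coeff m) =
      AddMonoidAlgebra.single 0 (s.coeff m) * mono k A m := by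
    simp [mono, AddMonoidAlgebra.single_mul_single]
  rw [heq]
  change toLocQuot k A F I _ ∈ K
  rw [← smul_toLocQuot]
  exact K.smul_mem _ (h m hm)

theorem toLocQuot_eq_zero_iff (hF : IsFace A F) (hI : IsMonomialIdeal k A I) {s : SGRing k A} :
    toLocQuot k A F I s = 0 ↔
      ∀ m ∈ s.coeff.support, ∃ f ∈ NSemi F, (m : Fin d → ℤ) + f ∈ expSet k A I := by
  have h : toLocQuot k A F I s = 0 ↔ algebraMap _ _ s ∈
      I.map (algebraMap (SGRing k A) (Localization.AtPrime (primeF k A F))) :=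
    Ideal.Quotient.eq_zero_iff_mem
  rw [h]
  conv_lhs => rw [hI.eq_span]
  rw [algebraMap_mem_map_span_mono_iff hF]
  simp only [locMem_iff (isExpSet_expSet I)]

theorem toLocQuot_mono_eq_zero_iff (hF : IsFace A F) (hI : IsMonomialIdeal k A I) {q : NSemi A} :
    toLocQuot k A F I (mono k A q) = 0 ↔
      ∃ f ∈ NSemi F, (q : Fin d → ℤ) + f ∈ expSet k A I := by
  rw [toLocQuot_eq_zero_iff hF hI]
  simp [support_mono]

theorem toLocQuot_mono_mem (hF : IsFace A F) {p q : NSemi A} (h : (p : Fin d → ℤ) - q ∈ ZGrp F)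
    {K : Submodule (Localization.AtPrime (primeF k A F)) (Localization.AtPrime (primeF k A F) ⧸
      I.map (algebraMap (SGRing k A) (Localization.AtPrime (primeF k A F))))}
    (hp : toLocQuot k A F I (mono k A p) ∈ K) : toLocQuot k A F I (mono k A q) ∈ K := by
  obtain ⟨f, hf, g, hg, hfg⟩ := exists_of_mem_ZGrp h
  lift f to NSemi A using NSemi_mono hF.1 hf
  lift g to NSemi A using NSemi_mono hF.1 hg
  have heq : g + p = f + q := Subtype.ext (by
    change (g : Fin d → ℤ) + p = f + q
    rw [← hfg]
    abel)
  rw [← Submodule.smul_mem_iff_of_isUnit _ (isUnit_algebraMap_mono hF hf), smul_toLocQuot,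
    ← mono_add, ← heq, mono_add, ← smul_toLocQuot]
  exact K.smul_mem _ hp

theorem IsTors.toLocQuot_mono_mem_torsion (hA : IsConfig A) (hF : IsFace A F)
    (hI : IsMonomialIdeal k A I) {q : NSemi A} (h : IsTors A F (expSet k A I) q) :
    ∃ n : ℕ, toLocQuot k A F I (mono k A q) ∈ Submodule.torsionBySet
      (Localization.AtPrime (primeF k A F))
      (Localization.AtPrime (primeF k A F) ⧸
        I.map (algebraMap (SGRing k A) (Localization.AtPrime (primeF k A F))))
      (((IsLocalRing.maximalIdeal (Localization.AtPrime (primeF k A F))) ^ n :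
        Ideal (Localization.AtPrime (primeF k A F))) : Set _) := by
  have := hA.isNoetherianRing k
  have : IsNoetherianRing (Localization.AtPrime (primeF k A F)) :=
    IsLocalization.isNoetherianRing (primeF k A F).primeCompl _ inferInstance
  let J : Ideal (Localization.AtPrime (primeF k A F)) :=
    Submodule.comap (LinearMap.toSpanSingleton _ _ (toLocQuot k A F I (mono k A q))) ⊥
  have hJ : ∀ r, r ∈ J ↔ r • toLocQuot k A F I (mono k A q) = 0 := fun r => by
    simp only [J, Submodule.mem_comap, Submodule.mem_bot, LinearMap.toSpanSingleton_apply]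
  have hle : IsLocalRing.maximalIdeal (Localization.AtPrime (primeF k A F)) ≤ J.radical := by
    rw [← Localization.AtPrime.map_eq_maximalIdeal, Ideal.map_le_iff_le_comap]
    refine Ideal.span_le.2 ?_
    rintro _ ⟨a, ha, rfl⟩
    refine mono_mem_of_forall_generator (algebraMap _ _) J.radical (fun v hvA hvF => ?_) a.2 ha
    obtain ⟨n, f, hf, hm⟩ := h v hvA hvF
    refine ⟨n, ?_⟩
    rw [hJ, ← map_pow, smul_toLocQuot, mono_pow, ← mono_add, toLocQuot_mono_eq_zero_iff hF hI]
    refine ⟨f, hf, ?_⟩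
    convert hm using 2
    exact add_comm _ _
  obtain ⟨n, hn⟩ := Ideal.exists_pow_le_of_le_radical_of_fg hle
    (IsNoetherian.noetherian _)
  refine ⟨n, (Submodule.mem_torsionBySet_iff _ _).2 fun r => ?_⟩
  exact (hJ _).1 (hn r.2)

theorem isTors_of_toLocQuot_mem_torsion (hF : IsFace A F)
    (hI : IsMonomialIdeal k A I) {s : SGRing k A} {n : ℕ}
    (h : toLocQuot k A F I s ∈ Submodule.torsionBySet
      (Localization.AtPrime (primeF k A F))
      (Localization.AtPrime (primeF k A F) ⧸
        I.map (algebraMap (SGRing k A) (Localization.AtPrime (primeF k A F))))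
      (((IsLocalRing.maximalIdeal (Localization.AtPrime (primeF k A F))) ^ n :
        Ideal (Localization.AtPrime (primeF k A F))) : Set _))
    {m : NSemi A} (hm : m ∈ s.coeff.support) : IsTors A F (expSet k A I) m := by
  intro v hv hvF
  lift v to NSemi A using AddSubmonoid.subset_closure hv
  have hvm : algebraMap (SGRing k A) (Localization.AtPrime (primeF k A F)) (mono k A v) ∈
      IsLocalRing.maximalIdeal (Localization.AtPrime (primeF k A F)) := by
    rw [← Localization.AtPrime.map_eq_maximalIdeal]
    exact Ideal.mem_map_of_mem _ (Ideal.subset_span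
      ⟨v, fun h => hvF (hF.mem_of_mem_NSemi hv h), rfl⟩)
  have h0 : algebraMap (SGRing k A) (Localization.AtPrime (primeF k A F)) (mono k A v) ^ n •
      toLocQuot k A F I s = 0 :=
    (Submodule.mem_torsionBySet_iff _ _).1 h ⟨_, Ideal.pow_mem_pow hvm n⟩
  rw [← map_pow, smul_toLocQuot, mono_pow, toLocQuot_eq_zero_iff hF hI] at h0
  obtain ⟨f, hf, hmem⟩ := h0 (n • v + m) (by
    rw [Finsupp.mem_support_iff] at hm ⊢
    rwa [mono, AddMonoidAlgebra.coeff_single_mul_add, one_mul])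
  refine ⟨n, f, hf, ?_⟩
  convert hmem using 2
  exact add_comm _ _

/-- A torsion exponent `q` gives either the zero class or, up to a unit, the monomial representing
an overlap class. -/
theorem IsTors.toLocQuot_mono_mem (hA : IsConfig A) (hF : IsFace A F) (hI : IsMonomialIdeal k A I)
    {q : NSemi A} (h : IsTors A F (expSet k A I) q)
    {K : Submodule (Localization.AtPrime (primeF k A F)) (Localization.AtPrime (primeF k A F) ⧸
      I.map (algebraMap (SGRing k A) (Localization.AtPrime (primeF k A F))))}
    (hK : ∀ i : OverlapClass A (expSet k A I) F,
      (OverlapClass.exponent k I i : Fin d → ℤ) - q ∈ ZGrp F →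
        toLocQuot k A F I (mono k A (OverlapClass.exponent k I i)) ∈ K) :
    toLocQuot k A F I (mono k A q) ∈ K := by
  rcases IsTors.exists_stdPair hA (isExpSet_expSet I) hF q.2 h with h | ⟨b, hb, hbq⟩
  · rw [(toLocQuot_mono_eq_zero_iff hF hI).2 h]
    exact K.zero_mem
  · have hi := OverlapClass.exponent_sub_mem hb rfl
    have hiq : (OverlapClass.exponent k I (Quot.mk _ ⟨b, hb⟩) : Fin d → ℤ) - q ∈ ZGrp F := by
      convert add_mem hi hbq using 1
      abel
    exact StdPairsPaper.toLocQuot_mono_mem hF hiq (hK _ hiq)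

theorem iSup_torsionBySet_eq_span (hA : IsConfig A) (hF : IsFace A F)
    (hI : IsMonomialIdeal k A I) :
    (⨆ n : ℕ, Submodule.torsionBySet
      (Localization.AtPrime (primeF k A F))
      (Localization.AtPrime (primeF k A F) ⧸
        I.map (algebraMap (SGRing k A) (Localization.AtPrime (primeF k A F))))
      (((IsLocalRing.maximalIdeal (Localization.AtPrime (primeF k A F))) ^ n :
        Ideal (Localization.AtPrime (primeF k A F))) : Set _)) =
      Submodule.span (Localization.AtPrime (primeF k A F)) (Set.range fun i =>
        toLocQuot k A F I (mono k A (OverlapClass.exponent k I (F := F) i))) := by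
  refine le_antisymm (iSup_le fun n y hy => ?_) (Submodule.span_le.2 ?_)
  · obtain ⟨r, rfl⟩ := Ideal.Quotient.mk_surjective y
    obtain ⟨⟨s, u⟩, hsu⟩ := IsLocalization.surj (primeF k A F).primeCompl r
    have hu := IsLocalization.map_units (Localization.AtPrime (primeF k A F)) u
    have heq : algebraMap (SGRing k A) (Localization.AtPrime (primeF k A F)) u •
        Ideal.Quotient.mk (I.map (algebraMap (SGRing k A)
          (Localization.AtPrime (primeF k A F)))) r = toLocQuot k A F I s := by
      rw [toLocQuot, ← hsu, mul_comm]
      rfl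
    rw [← Submodule.smul_mem_iff_of_isUnit _ hu, heq] at hy ⊢
    refine toLocQuot_mem_of_forall_mono fun m hm => ?_
    exact (isTors_of_toLocQuot_mem_torsion hF hI hy hm).toLocQuot_mono_mem hA hF hI
      fun i _ => Submodule.subset_span ⟨i, rfl⟩
  · rintro _ ⟨i, rfl⟩
    obtain ⟨n, hn⟩ := IsTors.toLocQuot_mono_mem_torsion hA hF hI
      (q := OverlapClass.exponent k I i) (i.out.2.isTors hA (isExpSet_expSet I))
    exact Submodule.mem_iSup_of_mem n hn

theorem smul_mem_of_forall_mono {r : Localization.AtPrime (primeF k A F)}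
    (hr : r ∈ IsLocalRing.maximalIdeal (Localization.AtPrime (primeF k A F)))
    {q : NSemi A}
    {K : Submodule (Localization.AtPrime (primeF k A F)) (Localization.AtPrime (primeF k A F) ⧸
      I.map (algebraMap (SGRing k A) (Localization.AtPrime (primeF k A F))))}
    (h : ∀ c : NSemi A, (c : Fin d → ℤ) ∉ NSemi F → toLocQuot k A F I (mono k A (q + c)) ∈ K) :
    r • toLocQuot k A F I (mono k A q) ∈ K := by
  suffices hle : IsLocalRing.maximalIdeal (Localization.AtPrime (primeF k A F)) ≤
      K.comap (LinearMap.toSpanSingleton _ _ (toLocQuot k A F I (mono k A q))) from hle hr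
  rw [← Localization.AtPrime.map_eq_maximalIdeal, Ideal.map_le_iff_le_comap]
  refine Ideal.span_le.2 ?_
  rintro _ ⟨c, hc, rfl⟩
  change algebraMap (SGRing k A) (Localization.AtPrime (primeF k A F)) (mono k A c) •
    toLocQuot k A F I (mono k A q) ∈ K
  rw [smul_toLocQuot, ← mono_add, add_comm]
  exact h c hc

theorem locMem_of_toLocQuot_mem_span (hF : IsFace A F) (hI : IsMonomialIdeal k A I)
    {S : Set (NSemi A)} {q : NSemi A}
    (h : toLocQuot k A F I (mono k A q) ∈ Submodule.span (Localization.AtPrime (primeF k A F))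
      ((fun a => toLocQuot k A F I (mono k A a)) '' S)) :
    LocMem F ({t | (t : Fin d → ℤ) ∈ expSet k A I} ∪ S) q := by
  let B := Localization.AtPrime (primeF k A F)
  let J : Ideal B := I.map (algebraMap (SGRing k A) B)
  let K : Ideal B := (Ideal.span (mono k A '' ({t | (t : Fin d → ℤ) ∈ expSet k A I} ∪ S))).map
    (algebraMap (SGRing k A) B)
  have hJK : J ≤ K := by
    refine Ideal.map_mono ?_
    conv_lhs => rw [hI.eq_span]
    exact Ideal.span_mono (Set.image_mono Set.subset_union_left)
  have hle : Submodule.span B ((fun a => toLocQuot k A F I (mono k A a)) '' S) ≤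
      Submodule.map J.mkQ K := by
    refine Submodule.span_le.2 ?_
    rintro _ ⟨a, ha, rfl⟩
    exact ⟨_, Ideal.mem_map_of_mem _ (Ideal.subset_span ⟨a, Or.inr ha, rfl⟩), rfl⟩
  have hmem : algebraMap (SGRing k A) B (mono k A q) ∈ K := by
    obtain ⟨z, hz, hzq⟩ := hle h
    have := hJK ((Submodule.Quotient.eq J).1 hzq)
    exact (Submodule.sub_mem_iff_right K hz).1 this
  exact (algebraMap_mem_map_span_mono_iff hF).1 hmem q (by simp [support_mono])

end MonomialIdeal

/-- Let `p_F` be an associated prime of the monomial ideal `I`,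
let `R = k[ℕA]_{p_F}`, `M = R/IR`, and let `N ⊆ M` be the submodule of elements
annihilated by some power of the maximal ideal of `R`.  Then `N` has finite length
as an `R`-module, equal to the number of overlap classes of standard pairs of `I`
belonging to `F`; we express this by the existence of a composition series of the
lattice of submodules of `N` from `⊥` to `⊤` of that length. -/
theorem multiplicity_eq_number_of_overlap_classes {d : ℕ} (k : Type*) [Field k]
    (A : Set (Fin d → ℤ)) (hA : IsConfig A)
    (F : Set (Fin d → ℤ)) (hF : IsFace A F)
    (I : Ideal (SGRing k A)) (hI : IsMonomialIdeal k A I)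
    [hP : (primeF k A F).IsPrime]
    (hass : primeF k A F ∈ associatedPrimes (SGRing k A) (SGRing k A ⧸ I)) :
    ∀ N : Submodule (Localization.AtPrime (primeF k A F))
        (Localization.AtPrime (primeF k A F) ⧸
          I.map (algebraMap (SGRing k A) (Localization.AtPrime (primeF k A F)))),
      N = (⨆ n : ℕ, Submodule.torsionBySet
            (Localization.AtPrime (primeF k A F))
            (Localization.AtPrime (primeF k A F) ⧸
              I.map (algebraMap (SGRing k A) (Localization.AtPrime (primeF k A F))))
            (((IsLocalRing.maximalIdeal (Localization.AtPrime (primeF k A F))) ^ n :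
              Ideal (Localization.AtPrime (primeF k A F))) : Set _)) →
      ∃ s : CompositionSeries
          (Submodule (Localization.AtPrime (primeF k A F)) N),
        s.head = ⊥ ∧ s.last = ⊤ ∧
        s.length = Nat.card (Quot (fun (x y : {a : Fin d → ℤ // StdPair A (expSet k A I) a F}) =>
          Overlap F x.1 y.1)) := by
  rintro N rfl
  obtain ⟨e, he⟩ := exists_overlapClass_enumeration hA hF I
  let x : Fin (Nat.card (OverlapClass A (expSet k A I) F)) → NSemi A := fun i =>
    OverlapClass.exponent k I (e i)
  have himage : ∀ s, (fun i => toLocQuot k A F I (mono k A (x i))) '' s =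
      (fun a => toLocQuot k A F I (mono k A a)) '' (x '' s) := fun s =>
    (Set.image_image (fun a => toLocQuot k A F I (mono k A a)) x s).symm
  refine exists_compositionSeries (fun i => toLocQuot k A F I (mono k A (x i))) _ ?_ ?_ ?_
  · rw [iSup_torsionBySet_eq_span hA hF hI]
    congr 1
    exact (e.surjective.range_comp _).symm
  · intro r hr i
    refine smul_mem_of_forall_mono hr fun c hc => ?_
    refine (((e i).out.2.isTors hA (isExpSet_expSet I)).add (isExpSet_expSet I)
      c.2).toLocQuot_mono_mem (q := x i + c) hA hF hI fun l hl => ?_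
    obtain ⟨j, rfl⟩ := e.surjective l
    have hle : j ≤ i := he j i ⟨c, c.2, by
      convert hl using 1
      exact sub_sub _ _ _⟩
    refine Submodule.subset_span ⟨j, lt_of_le_of_ne hle ?_, rfl⟩
    rintro rfl
    refine hc (hF.mem_NSemi_of_mem_ZGrp c.2 (neg_mem_iff.1 ?_))
    convert hl using 1
    exact (sub_add_cancel_left _ _).symm
  · intro i hi
    rw [himage] at hi
    obtain ⟨f, hf, t, ht | ⟨j, hj, rfl⟩, r, hr, heq⟩ := locMem_of_toLocQuot_mem_span hF hI hi
    · refine (e i).out.2.add_notMem hf ?_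
      have : (x i : Fin d → ℤ) + f ∈ expSet k A I := by
        rw [heq, add_comm]
        exact (isExpSet_expSet I).2 _ ht _ hr
      exact this
    · refine hj.not_ge (he i j ⟨r, hr, ?_⟩)
      convert neg_mem (NSemi_le_ZGrp hf) using 1
      change (x i : Fin d → ℤ) - x j - r = -f
      rw [eq_sub_of_add_eq heq]
      abel

end StdPairsPaper
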